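/- In the classical Polya urn started with a white and b black balls with reinforcement of m balls per draw, the limiting proportion of white balls follows the Beta(a/m, b/m) distribution. -/

import Mathlib

open MeasureTheory Filter

/-- The Beta(α, β) measure on [0,1], given by its density
`x^(α−1)(1−x)^(β−1)/B(α,β)` with `B(α,β) = Γ(α)Γ(β)/Γ(α+β)`. -/
noncomputable def betaMeasure (α β : ℝ) : Measure ℝ :=
  (volume.restrict (Set.Ioo (0 : ℝ) 1)).withDensity
    (fun x => ENNReal.ofReal
      (x ^ (α - 1) * (1 - x) ^ (β - 1) /
        (Real.Gamma α * Real.Gamma β / Real.Gamma (α + β))))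

def polyaR (k : ℕ) (x : ℝ) : ℝ := ∏ i ∈ Finset.range k, (x + i)

lemma polyaR_pos (k : ℕ) {x : ℝ} (hx : 0 < x) : 0 < polyaR k x :=
  Finset.prod_pos fun i _ => by positivity

lemma polyaR_shift (k : ℕ) (x : ℝ) : x * polyaR k (x + 1) = polyaR k x * (x + k) := by
  unfold polyaR
  rw [← Finset.prod_range_succ (fun i : ℕ => x + (i : ℝ)), Finset.prod_range_succ', mul_comm]
  congr 1
  · refine Finset.prod_congr rfl fun i _ => ?_
    push_cast; ring
  · simp

lemma polyaR_continuous (k : ℕ) : Continuous (polyaR k) := by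
  unfold polyaR; fun_prop

lemma polya_Gamma (k : ℕ) {x : ℝ} (hx : 0 < x) :
    Real.Gamma (x + k) = polyaR k x * Real.Gamma x := by
  induction k with
  | zero => simp [polyaR]
  | succ k ih =>
    have : x + ((k + 1 : ℕ) : ℝ) = (x + k) + 1 := by push_cast; ring
    rw [this, Real.Gamma_add_one (by positivity), ih]
    simp only [polyaR, Finset.prod_range_succ]
    ring

lemma polya_beta_univ {α β : ℝ} (hα : 0 < α) (hβ : 0 < β) : betaMeasure α β Set.univ = 1 := by
  rw [← ProbabilityTheory.lintegral_betaPDF_eq_one hα hβ, ProbabilityTheory.lintegral_betaPDF,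
    betaMeasure, withDensity_apply _ MeasurableSet.univ, Measure.restrict_univ]
  refine lintegral_congr fun x => ?_
  congr 1
  unfold ProbabilityTheory.beta
  ring

lemma polya_dens_nonneg {α β x : ℝ} (hα : 0 < α) (hβ : 0 < β) (hx : x ∈ Set.Ioo (0 : ℝ) 1) :
    0 ≤ x ^ (α - 1) * (1 - x) ^ (β - 1) /
        (Real.Gamma α * Real.Gamma β / Real.Gamma (α + β)) := by
  have h1 := Real.Gamma_pos_of_pos hα
  have h2 := Real.Gamma_pos_of_pos hβ
  have h3 := Real.Gamma_pos_of_pos (add_pos hα hβ)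
  have h4 := hx.1
  have h5 : 0 < 1 - x := by linarith [hx.2]
  positivity

lemma polya_beta_integral {α β : ℝ} (hα : 0 < α) (hβ : 0 < β) (f : ℝ → ℝ) :
    ∫ x, f x ∂(betaMeasure α β) = ∫ x in Set.Ioo (0 : ℝ) 1,
      (x ^ (α - 1) * (1 - x) ^ (β - 1) /
        (Real.Gamma α * Real.Gamma β / Real.Gamma (α + β))) * f x := by
  unfold betaMeasure
  rw [integral_withDensity_eq_integral_toReal_smul (by fun_prop) (by simp)]
  refine setIntegral_congr_fun measurableSet_Ioo fun x hx => ?_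
  simp only [smul_eq_mul]
  rw [ENNReal.toReal_ofReal (polya_dens_nonneg hα hβ hx)]

lemma polya_beta_moment {α β : ℝ} (hα : 0 < α) (hβ : 0 < β) (k : ℕ) :
    ∫ x, x ^ k ∂(betaMeasure α β) = polyaR k α / polyaR k (α + β) := by
  have hαk : 0 < α + k := by positivity
  have h1 := polya_beta_integral hαk hβ (fun _ => 1)
  have : IsProbabilityMeasure (betaMeasure (α + k) β) := ⟨polya_beta_univ hαk hβ⟩
  rw [integral_const] at h1
  simp only [probReal_univ, one_smul, mul_one] at h1
  rw [polya_beta_integral hα hβ]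
  refine Eq.trans ?_ ((congrArg (fun z => polyaR k α / polyaR k (α + β) * z) h1.symm).trans
    (mul_one _))
  rw [← integral_const_mul]
  refine setIntegral_congr_fun (measurableSet_Ioo (a := (0:ℝ)) (b := 1)) fun x hx => ?_
  have e : α + k + β = (α + β) + k := by ring
  have e2 : x ^ (α + k - 1) = x ^ (α - 1) * x ^ k := by
    rw [← Real.rpow_natCast x k, ← Real.rpow_add hx.1]; congr 1; ring
  rw [e, polya_Gamma k hα, polya_Gamma k (add_pos hα hβ), e2]
  have g1 := Real.Gamma_pos_of_pos hα
  have g2 := Real.Gamma_pos_of_pos hβ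
  have g3 := Real.Gamma_pos_of_pos (add_pos hα hβ)
  have g4 := polyaR_pos k hα
  have g5 := polyaR_pos k (add_pos hα hβ)
  field_simp

lemma polya_beta_supp (α β : ℝ) : ∀ᵐ x ∂(betaMeasure α β), x ∈ Set.Icc (0 : ℝ) 1 := by
  have h : ∀ᵐ x ∂(volume.restrict (Set.Ioo (0 : ℝ) 1)), x ∈ Set.Icc (0 : ℝ) 1 := by
    filter_upwards [ae_restrict_mem measurableSet_Ioo] with x hx
    exact Set.Ioo_subset_Icc_self hx
  exact (withDensity_absolutelyContinuous _ _).ae_le h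

lemma polya_int {μ : Measure ℝ} [IsProbabilityMeasure μ]
    (hμ : ∀ᵐ x ∂μ, x ∈ Set.Icc (0 : ℝ) 1) {f : ℝ → ℝ} (hf : Continuous f) : Integrable f μ := by
  obtain ⟨C, hC⟩ := (isCompact_Icc (a := (0:ℝ)) (b := 1)).exists_bound_of_continuousOn
    hf.continuousOn
  refine Integrable.of_bound hf.aestronglyMeasurable C ?_
  filter_upwards [hμ] with x hx using hC x hx

lemma polya_near {μ : Measure ℝ} [IsProbabilityMeasure μ]
    (hμ : ∀ᵐ x ∂μ, x ∈ Set.Icc (0 : ℝ) 1) {f g : ℝ → ℝ} (hf : Continuous f) (hg : Continuous g)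
    {ε : ℝ} (h : ∀ x ∈ Set.Icc (0 : ℝ) 1, |g x - f x| < ε) :
    |∫ x, g x ∂μ - ∫ x, f x ∂μ| ≤ ε := by
  rw [← integral_sub (polya_int hμ hg) (polya_int hμ hf), ← Real.norm_eq_abs]
  have := norm_integral_le_of_norm_le_const (μ := μ) (f := fun x => g x - f x) (C := ε) (by
    filter_upwards [hμ] with x hx using (h x hx).le)
  simpa using this

lemma polya_ext {μ ν : Measure ℝ} [IsProbabilityMeasure μ] [IsProbabilityMeasure ν]
    (hμ : ∀ᵐ x ∂μ, x ∈ Set.Icc (0 : ℝ) 1) (hν : ∀ᵐ x ∂ν, x ∈ Set.Icc (0 : ℝ) 1)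
    (h : ∀ k : ℕ, ∫ x, x ^ k ∂μ = ∫ x, x ^ k ∂ν) : μ = ν := by
  have hp : ∀ p : Polynomial ℝ, ∫ x, p.eval x ∂μ = ∫ x, p.eval x ∂ν := by
    intro p
    simp only [Polynomial.eval_eq_sum_range]
    rw [integral_finsetSum _ fun i _ => polya_int hμ (by fun_prop),
      integral_finsetSum _ fun i _ => polya_int hν (by fun_prop)]
    simp only [integral_const_mul, h]
  refine ext_of_forall_integral_eq_of_IsFiniteMeasure fun f => ?_
  refine eq_of_abs_sub_le_all fun ε hε => ?_
  obtain ⟨p, hpf⟩ := exists_polynomial_near_of_continuousOn 0 1 f f.continuous.continuousOn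
    (ε / 2) (half_pos hε)
  have a1 := polya_near hμ f.continuous p.continuous hpf
  have a2 := polya_near hν f.continuous p.continuous hpf
  rw [hp p] at a1
  rw [abs_le] at *
  constructor <;> linarith [a1.1, a1.2, a2.1, a2.2]

section
variable {Ω : Type*} {m0 : MeasurableSpace Ω} {μ : Measure Ω} [IsProbabilityMeasure μ]

lemma polya_bounds {w : ℕ → Ω → ℝ} {α : ℝ} (h0 : ∀ ω, w 0 ω = α)
    (hstep : ∀ t ω, w (t + 1) ω - w t ω = 0 ∨ w (t + 1) ω - w t ω = 1) (t : ℕ) (ω : Ω) :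
    w t ω ∈ Set.Icc α (α + t) := by
  induction t with
  | zero => simp [h0]
  | succ t ih =>
    obtain ⟨h1, h2⟩ := ih
    push_cast
    rcases hstep t ω with h | h <;> constructor <;> linarith

lemma polya_bdd_int {F : Filtration ℕ m0} {w : ℕ → Ω → ℝ} {α : ℝ} (h0 : ∀ ω, w 0 ω = α)
    (hw : ∀ t, StronglyMeasurable[F t] (w t))
    (hstep : ∀ t ω, w (t + 1) ω - w t ω = 0 ∨ w (t + 1) ω - w t ω = 1) (t : ℕ)
    {f : ℝ → ℝ} (hf : Continuous f) : Integrable (fun ω => f (w t ω)) μ := by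
  obtain ⟨C, hC⟩ := (isCompact_Icc (a := α) (b := α + t)).exists_bound_of_continuousOn
    hf.continuousOn
  refine Integrable.of_bound
    (hf.comp_stronglyMeasurable ((hw t).mono (F.le t))).aestronglyMeasurable C ?_
  exact Eventually.of_forall fun ω => hC _ (polya_bounds h0 hstep t ω)

lemma polya_moment_step {F : Filtration ℕ m0} {w : ℕ → Ω → ℝ} {α s : ℝ} (h0 : ∀ ω, w 0 ω = α)
    (hs : 0 < s)
    (hw : ∀ t, StronglyMeasurable[F t] (w t))
    (hstep : ∀ t ω, w (t + 1) ω - w t ω = 0 ∨ w (t + 1) ω - w t ω = 1)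
    (hdraw : ∀ t, μ[fun ω => w (t + 1) ω - w t ω | F t] =ᵐ[μ] fun ω => w t ω / (s + t))
    (k t : ℕ) :
    ∫ ω, polyaR k (w (t + 1) ω) ∂μ = (s + t + k) / (s + t) * ∫ ω, polyaR k (w t ω) ∂μ := by
  have hst : 0 < s + t := by positivity
  have hc := polyaR_continuous k
  set g : ℝ → ℝ := fun x => polyaR k (x + 1) - polyaR k x with hg
  have hgc : Continuous g := by fun_prop
  have e1 : ∀ ω, polyaR k (w (t + 1) ω)
      = polyaR k (w t ω) + g (w t ω) * (w (t + 1) ω - w t ω) := by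
    intro ω
    rcases hstep t ω with h | h
    · rw [h, sub_eq_zero.1 h]; ring
    · rw [h, show w (t + 1) ω = w t ω + 1 by linarith]; simp [hg]
  have iD : Integrable (fun ω => w (t + 1) ω - w t ω) μ :=
    (polya_bdd_int h0 hw hstep (t + 1) continuous_id).sub
      (polya_bdd_int h0 hw hstep t continuous_id)
  have iR := polya_bdd_int (μ := μ) h0 hw hstep t hc
  have iR' := polya_bdd_int (μ := μ) h0 hw hstep (t + 1) hc
  have igD : Integrable (fun ω => g (w t ω) * (w (t + 1) ω - w t ω)) μ := by
    refine (iR'.sub iR).congr (Eventually.of_forall fun ω => ?_)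
    simp only [Pi.sub_apply, e1 ω]; ring
  have key : ∫ ω, g (w t ω) * (w (t + 1) ω - w t ω) ∂μ
      = ∫ ω, g (w t ω) * (w t ω / (s + t)) ∂μ := by
    rw [← integral_condExp (F.le t)]
    refine integral_congr_ae ?_
    have h1 := condExp_mul_of_stronglyMeasurable_left (μ := μ) (m := F t)
      (f := fun ω => g (w t ω)) (g := fun ω => w (t + 1) ω - w t ω)
      (hgc.comp_stronglyMeasurable (hw t)) igD iD
    refine h1.trans ?_
    filter_upwards [hdraw t] with ω h
    simp only [Pi.mul_apply, h]
  have i3 : Integrable (fun ω => g (w t ω) * (w t ω / (s + t))) μ :=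
    polya_bdd_int (f := fun x => g x * (x / (s + t))) h0 hw hstep t (by fun_prop)
  simp_rw [e1]
  rw [integral_add iR igD, key, ← integral_add iR i3, ← integral_const_mul]
  refine integral_congr_ae (Eventually.of_forall fun ω => ?_)
  have := polyaR_shift k (w t ω)
  simp only [hg]
  field_simp
  linear_combination this

lemma polya_moment {F : Filtration ℕ m0} {w : ℕ → Ω → ℝ} {α s : ℝ} (h0 : ∀ ω, w 0 ω = α)
    (hs : 0 < s)
    (hw : ∀ t, StronglyMeasurable[F t] (w t))
    (hstep : ∀ t ω, w (t + 1) ω - w t ω = 0 ∨ w (t + 1) ω - w t ω = 1)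
    (hdraw : ∀ t, μ[fun ω => w (t + 1) ω - w t ω | F t] =ᵐ[μ] fun ω => w t ω / (s + t))
    (k t : ℕ) :
    ∫ ω, polyaR k (w t ω) / polyaR k (s + t) ∂μ = polyaR k α / polyaR k s := by
  rw [integral_div]
  induction t with
  | zero => simp [h0]
  | succ t ih =>
    rw [polya_moment_step h0 hs hw hstep hdraw, ← ih]
    have hst : 0 < s + t := by positivity
    have h1 := polyaR_shift k (s + t)
    have e : s + ((t + 1 : ℕ) : ℝ) = s + t + 1 := by push_cast; ring
    have h2 := polyaR_pos k hst
    have h3 : 0 < polyaR k (s + t + 1) := polyaR_pos k (by positivity)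
    rw [e]
    field_simp
    linear_combination (-∫ ω, polyaR k (w t ω) ∂μ) * h1

lemma polya_main {F : Filtration ℕ m0} {w : ℕ → Ω → ℝ} {α β : ℝ} (hα : 0 < α) (hβ : 0 < β)
    (h0 : ∀ ω, w 0 ω = α)
    (hw : ∀ t, StronglyMeasurable[F t] (w t))
    (hstep : ∀ t ω, w (t + 1) ω - w t ω = 0 ∨ w (t + 1) ω - w t ω = 1)
    (hdraw : ∀ t, μ[fun ω => w (t + 1) ω - w t ω | F t] =ᵐ[μ] fun ω => w t ω / (α + β + t))
    {L : Ω → ℝ} (hL : Measurable L)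
    (hconv : ∀ᵐ ω ∂μ, Tendsto (fun t : ℕ => w t ω / (α + β + t)) atTop (nhds (L ω))) :
    Measure.map L μ = betaMeasure α β := by
  have hs : 0 < α + β := by positivity
  have : IsProbabilityMeasure (betaMeasure α β) := ⟨polya_beta_univ hα hβ⟩
  have : IsProbabilityMeasure (Measure.map L μ) :=
    Measure.isProbabilityMeasure_map hL.aemeasurable
  refine polya_ext ?_ (polya_beta_supp α β) fun k => ?_
  · refine (ae_map_iff (p := fun x => x ∈ Set.Icc (0:ℝ) 1) hL.aemeasurable measurableSet_Icc).2 ?_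
    filter_upwards [hconv] with ω h
    refine isClosed_Icc.mem_of_tendsto h (Eventually.of_forall fun t => ?_)
    obtain ⟨h1, h2⟩ := polya_bounds h0 hstep t ω
    have hst : 0 < α + β + t := by positivity
    exact ⟨div_nonneg (by linarith) hst.le, (div_le_one hst).2 (by linarith)⟩
  · rw [polya_beta_moment hα hβ, integral_map hL.aemeasurable (by fun_prop)]
    have lim : Tendsto (fun t : ℕ => ∫ ω, polyaR k (w t ω) / polyaR k (α + β + t) ∂μ) atTop
        (nhds (∫ ω, L ω ^ k ∂μ)) := by
      refine tendsto_integral_of_dominated_convergence (fun _ => 1) (fun t => ?_)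
        (integrable_const _) (fun t => Eventually.of_forall fun ω => ?_) ?_
      · exact ((polya_bdd_int h0 hw hstep t (polyaR_continuous k)).div_const _).1
      · obtain ⟨h1, h2⟩ := polya_bounds h0 hstep t ω
        have hwp : 0 < w t ω := by linarith
        have hst : 0 < α + β + t := by positivity
        rw [Real.norm_eq_abs, abs_of_nonneg (div_nonneg (polyaR_pos k hwp).le
          (polyaR_pos k hst).le), div_le_one (polyaR_pos k hst)]
        exact Finset.prod_le_prod (fun i _ => by positivity) fun i _ => by linarith
      · filter_upwards [hconv] with ω h
        have hS : Tendsto (fun t : ℕ => α + β + (t : ℝ)) atTop atTop :=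
          tendsto_atTop_add_const_left _ _ tendsto_natCast_atTop_atTop
        have hf : ∀ i : ℕ, Tendsto (fun t : ℕ => (w t ω + i) / (α + β + t + i)) atTop
            (nhds (L ω)) := by
          intro i
          have hi : Tendsto (fun t : ℕ => (i : ℝ) / (α + β + t)) atTop (nhds 0) :=
            hS.const_div_atTop _
          have := (h.add hi).div (tendsto_const_nhds (x := (1:ℝ)) |>.add hi) (by norm_num)
          simp only [add_zero, div_one] at this
          refine this.congr fun t => ?_
          have hst : 0 < α + β + t := by positivity
          simp only [Pi.div_apply]
          field_simp
        have := tendsto_finsetProd (Finset.range k) fun i _ => hf i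
        simp only [Finset.prod_div_distrib, Finset.prod_const, Finset.card_range] at this
        exact this
    simp only [polya_moment h0 hs hw hstep hdraw] at lim
    exact tendsto_nhds_unique lim tendsto_const_nhds |>.symm ▸ rfl
end

/-- In the classical Polya urn started with `a` white and `b` black balls with
reinforcement of `m` balls per draw, the limiting proportion of white balls follows the
Beta(a/m, b/m) distribution. -/
theorem polya_limit_beta
    {Ω : Type*} {m0 : MeasurableSpace Ω} (μ : Measure Ω) [IsProbabilityMeasure μ]
    (F : Filtration ℕ m0)
    (a b m : ℕ) (ha : 1 ≤ a) (hb : 1 ≤ b) (hm : 1 ≤ m)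
    (W : ℕ → Ω → ℝ)
    (hW0 : ∀ ω, W 0 ω = a)
    (hWadapted : ∀ t, StronglyMeasurable[F t] (W t))
    (hWstep : ∀ t ω, W (t + 1) ω - W t ω = 0 ∨ W (t + 1) ω - W t ω = m)
    (hdraw : ∀ t, μ[fun ω => W (t + 1) ω - W t ω | F t]
      =ᵐ[μ] fun ω => m * W t ω / (a + b + m * t))
    (Wlim : Ω → ℝ) (hWlimMeas : Measurable Wlim)
    (hconv : ∀ᵐ ω ∂μ,
      Tendsto (fun t => W t ω / (a + b + m * t)) atTop (nhds (Wlim ω))) :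
    Measure.map Wlim μ = betaMeasure (a / m) (b / m) := by
  have hm' : (0:ℝ) < m := by exact_mod_cast hm
  have ha' : (0:ℝ) < a := by exact_mod_cast ha
  have hb' : (0:ℝ) < b := by exact_mod_cast hb
  have e : ∀ (t : ℕ) (x : ℝ), x / m / ((a:ℝ) / m + b / m + t) = x / (a + b + m * t) := by
    intro t x
    have : (0:ℝ) < a + b + m * t := by positivity
    have : (0:ℝ) < (a:ℝ) / m + b / m + t := by positivity
    field_simp
  refine polya_main (F := F) (w := fun t ω => W t ω / m) (by positivity) (by positivity)
    (fun ω => by simp [hW0]) (fun t => by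
      simp only [div_eq_mul_inv]
      exact (hWadapted t).mul stronglyMeasurable_const) (fun t ω => ?_) (fun t => ?_)
    hWlimMeas ?_
  · rcases hWstep t ω with h | h
    · left; rw [← sub_div, h, zero_div]
    · right; rw [← sub_div, h, div_self hm'.ne']
  · have h1 := condExp_smul (μ := μ) (1 / (m:ℝ)) (fun ω => W (t + 1) ω - W t ω) (F t)
    have h2 : (fun ω => W (t + 1) ω / m - W t ω / m)
        = (1 / (m:ℝ)) • (fun ω => W (t + 1) ω - W t ω) := by
      ext ω; simp only [Pi.smul_apply, smul_eq_mul]; ring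
    simp only [h2]
    refine h1.trans ?_
    filter_upwards [hdraw t] with ω h
    rw [Pi.smul_apply, h, e, smul_eq_mul]
    field_simp
  · filter_upwards [hconv] with ω h
    simpa only [e] using h
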